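/- Let φ : B ↠ A be an epimorphism of finite-dimensional k-algebras and ℳ a full subcategory of mod(B) containing mod(A). Then (1) the poset widshad_ℳ(B) of ℳ-wide shadows is a complete lattice, and (2) the maps (−) ∩ ℳ : wide(B) → widshad_ℳ(B) and (−) ∩ mod(A) : widshad_ℳ(B) → wide(A) are surjective meet-semilattice homomorphisms. -/

import Mathlib

noncomputable section

variable (Λ : Type) [Ring Λ]

/-- The objects of `mod Λ`: finitely generated `Λ`-modules. -/
def fgMods : Set (ModuleCat Λ) := {M | Module.Finite Λ M}

/-- A torsion class of the (exact) subcategory of `Mod Λ` with objects `amb`: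
a full additive iso-closed subcategory of `amb` closed under quotients and
extensions (taken inside `amb`). -/
def IsTorsionClassIn (amb T : Set (ModuleCat Λ)) : Prop :=
  T ⊆ amb ∧
  (∀ M N : ModuleCat Λ, M ∈ T → N ∈ amb → Nonempty (M ≃ₗ[Λ] N) → N ∈ T) ∧
  (∀ M : ModuleCat Λ, M ∈ amb → (∀ x : M, x = 0) → M ∈ T) ∧
  (∀ M N P : ModuleCat Λ, M ∈ T → N ∈ T → P ∈ amb →
    (∃ (i : M →ₗ[Λ] P) (j : N →ₗ[Λ] P),
      Function.Bijective (fun q : M × N => i q.1 + j q.2)) → P ∈ T) ∧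
  (∀ M ∈ T, ∀ N ∈ amb, ∀ f : M →ₗ[Λ] N, Function.Surjective f → N ∈ T) ∧
  (∀ X Z : ModuleCat Λ, X ∈ T → Z ∈ T → ∀ Y ∈ amb, ∀ (f : X →ₗ[Λ] Y) (g : Y →ₗ[Λ] Z),
    Function.Injective f → Function.Surjective g → Function.Exact f g → Y ∈ T)

/-- A torsion class of `mod Λ`. -/
def IsTorsionClassCat (T : Set (ModuleCat Λ)) : Prop := IsTorsionClassIn Λ (fgMods Λ) T

/-- A wide subcategory of the subcategory of `Mod Λ` with objects `amb`:
full, abelian (closed under kernels and cokernels) and closed under extensions. -/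
def IsWideIn (amb W : Set (ModuleCat Λ)) : Prop :=
  W ⊆ amb ∧
  (∀ M N : ModuleCat Λ, M ∈ W → N ∈ amb → Nonempty (M ≃ₗ[Λ] N) → N ∈ W) ∧
  (∀ M : ModuleCat Λ, M ∈ amb → (∀ x : M, x = 0) → M ∈ W) ∧
  (∀ M N P : ModuleCat Λ, M ∈ W → N ∈ W → P ∈ amb →
    (∃ (i : M →ₗ[Λ] P) (j : N →ₗ[Λ] P),
      Function.Bijective (fun q : M × N => i q.1 + j q.2)) → P ∈ W) ∧
  (∀ M N : ModuleCat Λ, M ∈ W → N ∈ W → ∀ f : M →ₗ[Λ] N, ∀ K ∈ amb,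
    Nonempty (K ≃ₗ[Λ] ↥(LinearMap.ker f)) → K ∈ W) ∧
  (∀ M N : ModuleCat Λ, M ∈ W → N ∈ W → ∀ f : M →ₗ[Λ] N, ∀ C ∈ amb,
    Nonempty (C ≃ₗ[Λ] (N ⧸ LinearMap.range f)) → C ∈ W) ∧
  (∀ X Z : ModuleCat Λ, X ∈ W → Z ∈ W → ∀ Y ∈ amb, ∀ (f : X →ₗ[Λ] Y) (g : Y →ₗ[Λ] Z),
    Function.Injective f → Function.Surjective g → Function.Exact f g → Y ∈ W)

/-- A wide subcategory of `mod Λ`. -/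
def IsWideCat (W : Set (ModuleCat Λ)) : Prop := IsWideIn Λ (fgMods Λ) W

/-- `Gen M`: finitely generated quotients of finite direct sums of copies of `M`. -/
def GenBy (M : ModuleCat Λ) : Set (ModuleCat Λ) :=
  {N | Module.Finite Λ N ∧ ∃ (n : ℕ) (f : (Fin n → M) →ₗ[Λ] N), Function.Surjective f}

/-- `Filt 𝒞`: modules admitting a finite filtration with subquotients in `𝒞`. -/
def FiltOf (C : Set (ModuleCat Λ)) : Set (ModuleCat Λ) :=
  {M | Module.Finite Λ M ∧ ∃ (d : ℕ) (F : Fin (d + 1) → Submodule Λ M),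
    Monotone F ∧ F 0 = ⊥ ∧ F (Fin.last d) = ⊤ ∧
    ∀ i : Fin d, ∃ N ∈ C,
      Nonempty (((F i.succ) ⧸ (Submodule.comap (F i.succ).subtype (F i.castSucc))) ≃ₗ[Λ] N)}

/-- An `ℳ`-torsion shadow. -/
def IsTorsionShadow (Mcal S : Set (ModuleCat Λ)) : Prop :=
  ∃ T : Set (ModuleCat Λ), IsTorsionClassCat Λ T ∧ S = T ∩ Mcal

/-- An `ℳ`-wide shadow. -/
def IsWideShadow (Mcal S : Set (ModuleCat Λ)) : Prop :=
  ∃ W : Set (ModuleCat Λ), IsWideCat Λ W ∧ S = W ∩ Mcal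

variable {Λ' : Type} [Ring Λ']

/-- `mod Λ'` viewed inside `mod Λ` via a surjective homomorphism `φ : Λ → Λ'`:
finitely generated modules on which `ker φ` acts by zero. -/
def modOver (φ : Λ →+* Λ') : Set (ModuleCat Λ) :=
  {M | Module.Finite Λ M ∧ ∀ x : Λ, φ x = 0 → ∀ m : M, x • m = 0}

/-- Least upper bound of the family `s` within the inclusion-ordered class `P`. -/
def IsLubIn {X : Type*} (P : Set (Set X)) (s : Set (Set X)) (j : Set X) : Prop :=
  j ∈ P ∧ (∀ a ∈ s, a ⊆ j) ∧ ∀ u ∈ P, (∀ a ∈ s, a ⊆ u) → j ⊆ u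

/-- Greatest lower bound of the family `s` within the inclusion-ordered class `P`. -/
def IsGlbIn {X : Type*} (P : Set (Set X)) (s : Set (Set X)) (m : Set X) : Prop :=
  m ∈ P ∧ (∀ a ∈ s, m ⊆ a) ∧ ∀ u ∈ P, (∀ a ∈ s, u ⊆ a) → u ⊆ m

end

open Function

universe v

section WideSubcategories

variable {Λ : Type} [Ring Λ]

theorem IsWideIn.inter_sInter {amb : Set (ModuleCat.{v} Λ)} {C : Set (Set (ModuleCat.{v} Λ))}
    (hC : ∀ W ∈ C, ∃ amb', amb ⊆ amb' ∧ IsWideIn Λ amb' W) : IsWideIn Λ amb (amb ∩ ⋂₀ C) := by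
  refine ⟨Set.inter_subset_left, ?_, ?_, ?_, ?_, ?_, ?_⟩
  · intro M N hM hN e
    refine ⟨hN, fun W hW => ?_⟩
    obtain ⟨amb', h, -, h1, -⟩ := hC W hW
    exact h1 M N (hM.2 W hW) (h hN) e
  · intro M hM h0
    refine ⟨hM, fun W hW => ?_⟩
    obtain ⟨amb', h, -, -, h1, -⟩ := hC W hW
    exact h1 M (h hM) h0
  · intro M N P hM hN hP e
    refine ⟨hP, fun W hW => ?_⟩
    obtain ⟨amb', h, -, -, -, h1, -⟩ := hC W hW
    exact h1 M N P (hM.2 W hW) (hN.2 W hW) (h hP) e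
  · intro M N hM hN f K hK e
    refine ⟨hK, fun W hW => ?_⟩
    obtain ⟨amb', h, -, -, -, -, h1, -⟩ := hC W hW
    exact h1 M N (hM.2 W hW) (hN.2 W hW) f K (h hK) e
  · intro M N hM hN f K hK e
    refine ⟨hK, fun W hW => ?_⟩
    obtain ⟨amb', h, -, -, -, -, -, h1, -⟩ := hC W hW
    exact h1 M N (hM.2 W hW) (hN.2 W hW) f K (h hK) e
  · intro X Z hX hZ Y hY f g hf hg hfg
    refine ⟨hY, fun W hW => ?_⟩
    obtain ⟨amb', h, -, -, -, -, -, -, h1⟩ := hC W hW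
    exact h1 X Z (hX.2 W hW) (hZ.2 W hW) Y (h hY) f g hf hg hfg

theorem IsWideIn.inter_of_subset {amb amb' W : Set (ModuleCat.{v} Λ)} (h : amb' ⊆ amb)
    (hW : IsWideIn Λ amb W) : IsWideIn Λ amb' (W ∩ amb') := by
  have := IsWideIn.inter_sInter (amb := amb') (C := {W}) (by
    rintro _ rfl
    exact ⟨amb, h, hW⟩)
  rwa [Set.sInter_singleton, Set.inter_comm] at this

theorem IsWideIn.inter {amb W W' : Set (ModuleCat.{v} Λ)} (hW : IsWideIn Λ amb W)
    (hW' : IsWideIn Λ amb W') : IsWideIn Λ amb (W ∩ W') := by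
  have := IsWideIn.inter_sInter (amb := amb) (C := {W, W'}) (by
    rintro _ (rfl | rfl)
    exacts [⟨amb, subset_rfl, hW⟩, ⟨amb, subset_rfl, hW'⟩])
  rwa [Set.sInter_pair, Set.inter_eq_right.2 (Set.inter_subset_left.trans hW.1)] at this

theorem IsWideShadow.exists_isGlbIn {Mcal : Set (ModuleCat.{v} Λ)} (hM : Mcal ⊆ fgMods Λ)
    {s : Set (Set (ModuleCat.{v} Λ))} (hs : ∀ S ∈ s, IsWideShadow Λ Mcal S) :
    ∃ m, IsGlbIn {S | IsWideShadow Λ Mcal S} s m := by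
  let C : Set (Set (ModuleCat.{v} Λ)) := {W | IsWideCat Λ W ∧ W ∩ Mcal ∈ s}
  refine ⟨(fgMods Λ ∩ ⋂₀ C) ∩ Mcal, ⟨_, ?_, rfl⟩, ?_, ?_⟩
  · exact IsWideIn.inter_sInter fun W hW => ⟨_, subset_rfl, hW.1⟩
  · intro S hS X hX
    obtain ⟨W, hW, rfl⟩ := hs S hS
    exact ⟨hX.1.2 W ⟨hW, hS⟩, hX.2⟩
  · rintro _ ⟨U, hU, rfl⟩ h X hX
    exact ⟨⟨hM hX.2, fun W hW => (h _ hW.2 hX).1⟩, hX.2⟩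

theorem IsWideShadow.exists_isLubIn {Mcal : Set (ModuleCat.{v} Λ)} (hM : Mcal ⊆ fgMods Λ)
    {s : Set (Set (ModuleCat.{v} Λ))} (hs : ∀ S ∈ s, IsWideShadow Λ Mcal S) :
    ∃ j, IsLubIn {S | IsWideShadow Λ Mcal S} s j := by
  obtain ⟨j, hj, hlow, hgreat⟩ := IsWideShadow.exists_isGlbIn hM
    (s := {U | IsWideShadow Λ Mcal U ∧ ∀ a ∈ s, a ⊆ U}) fun U hU => hU.1
  exact ⟨j, hj, fun a ha => hgreat a (hs a ha) fun U hU => hU.2 a ha,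
    fun u hu h => hlow u ⟨hu, h⟩⟩

theorem IsWideShadow.inter {Mcal S S' : Set (ModuleCat.{v} Λ)} (hS : IsWideShadow Λ Mcal S)
    (hS' : IsWideShadow Λ Mcal S') : IsWideShadow Λ Mcal (S ∩ S') := by
  obtain ⟨W, hW, rfl⟩ := hS
  obtain ⟨W', hW', rfl⟩ := hS'
  exact ⟨W ∩ W', hW.inter hW', (Set.inter_inter_distrib_right W W' Mcal).symm⟩

theorem isGlbIn_pair_inter {X : Type*} {P : Set (Set X)} {S S' : Set X} (h : S ∩ S' ∈ P) :
    IsGlbIn P {S, S'} (S ∩ S') := by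
  refine ⟨h, ?_, fun u _ hu => Set.subset_inter (hu S (by simp)) (hu S' (by simp))⟩
  rintro _ (rfl | rfl)
  exacts [Set.inter_subset_left, Set.inter_subset_right]

theorem IsGlbIn.eq {X : Type*} {P s : Set (Set X)} {m m' : Set X} (h : IsGlbIn P s m)
    (h' : IsGlbIn P s m') : m = m' :=
  (h'.2.2 m h.1 h.2.1).antisymm (h.2.2 m' h'.1 h'.2.1)

theorem isGlbIn_pair_inter_right {X : Type*} {P Q : Set (Set X)} {S S' m N : Set X}
    (h : S ∩ S' ∈ P) (hQ : (S ∩ N) ∩ (S' ∩ N) ∈ Q) (hm : IsGlbIn P {S, S'} m) :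
    IsGlbIn Q {S ∩ N, S' ∩ N} (m ∩ N) := by
  rw [hm.eq (isGlbIn_pair_inter h), Set.inter_inter_distrib_right]
  exact isGlbIn_pair_inter hQ

theorem modOver_subset_fgMods {Λ' : Type} [Ring Λ'] (φ : Λ →+* Λ') :
    modOver.{v} Λ φ ⊆ fgMods.{v} Λ := fun _ hM => hM.1

end WideSubcategories

section Factorization

variable {R : Type*} [Ring R] {X Y Z : Type*} [AddCommGroup X] [AddCommGroup Y] [AddCommGroup Z]
  [Module R X] [Module R Y] [Module R Z]

theorem LinearMap.exists_comp_eq_of_surjective (q : X →ₗ[R] Y) (hq : Surjective q)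
    (h : X →ₗ[R] Z) (hle : ∀ x, q x = 0 → h x = 0) : ∃ h' : Y →ₗ[R] Z, ∀ x, h' (q x) = h x := by
  refine ⟨(LinearMap.ker q).liftQ h hle ∘ₗ (q.quotKerEquivOfSurjective hq).symm.toLinearMap,
    fun x => ?_⟩
  have : (q.quotKerEquivOfSurjective hq).symm (q x) = Submodule.Quotient.mk x := by
    rw [LinearEquiv.symm_apply_eq]
    rfl
  rw [LinearMap.comp_apply, LinearEquiv.coe_coe, this]
  exact Submodule.liftQ_apply _ _ _

theorem LinearMap.exists_comp_eq_of_injective (i : X →ₗ[R] Y) (hi : Injective i)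
    (h : Z →ₗ[R] Y) (hle : ∀ z, ∃ x, i x = h z) : ∃ h' : Z →ₗ[R] X, ∀ z, i (h' z) = h z := by
  refine ⟨(LinearEquiv.ofInjective i hi).symm.toLinearMap ∘ₗ h.codRestrict (LinearMap.range i) hle,
    fun z => ?_⟩
  have := LinearEquiv.apply_symm_apply (LinearEquiv.ofInjective i hi)
    (h.codRestrict (LinearMap.range i) hle z)
  exact congrArg Subtype.val this

end Factorization

section Filtrations

variable {Λ : Type} [Ring Λ]

/-- Modules admitting a finite filtration with subquotients in `V`, built up by
repeatedly extending by an object of `V` as a submodule. -/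
inductive FiltBy (V : Set (ModuleCat.{v} Λ)) : ModuleCat.{v} Λ → Prop
  | zero (M : ModuleCat.{v} Λ) (h : ∀ x : M, x = 0) : FiltBy V M
  | ext (X Y Z : ModuleCat.{v} Λ) (i : X →ₗ[Λ] Y) (q : Y →ₗ[Λ] Z) (hi : Injective i)
      (hq : Surjective q) (hiq : Exact i q) (hX : X ∈ V) (hZ : FiltBy V Z) : FiltBy V Y

namespace FiltBy

variable {V : Set (ModuleCat.{v} Λ)}

theorem of_linearEquiv {M N : ModuleCat.{v} Λ} (hM : FiltBy V M) (e : M ≃ₗ[Λ] N) :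
    FiltBy V N := by
  cases hM with
  | zero _ h =>
    refine .zero _ fun x => ?_
    rw [← e.apply_symm_apply x, h (e.symm x), map_zero]
  | ext X _ Z i q hi hq hiq hX hZ =>
    refine .ext X N Z (e.toLinearMap ∘ₗ i) (q ∘ₗ e.symm.toLinearMap) (e.injective.comp hi)
      (hq.comp e.symm.surjective) (fun y => ?_) hX hZ
    refine (hiq (e.symm y)).trans (exists_congr fun x => ?_)
    exact e.eq_symm_apply

theorem of_mem {M : ModuleCat.{v} Λ} (hM : M ∈ V) : FiltBy V M :=
  .ext M M (.of Λ PUnit) LinearMap.id 0 injective_id (fun _ => ⟨0, rfl⟩)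
    (fun y => ⟨fun _ => ⟨y, rfl⟩, fun _ => rfl⟩) hM (.zero _ fun _ => rfl)

theorem finite (hV : V ⊆ fgMods Λ) {M : ModuleCat.{v} Λ} (hM : FiltBy V M) :
    Module.Finite Λ M := by
  induction hM with
  | zero M h =>
    have : Subsingleton M := ⟨fun a b => (h a).trans (h b).symm⟩
    infer_instance
  | ext X Y Z i q hi hq hiq hX hZ ih =>
    have : Module.Finite Λ X := hV hX
    have hker : LinearMap.ker q = LinearMap.range i := hiq.linearMap_ker_eq
    refine ⟨Submodule.fg_of_fg_map_of_fg_inf_ker q ?_ ?_⟩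
    · rw [Submodule.map_top, LinearMap.range_eq_top.2 hq]
      exact ih.fg_top
    · rw [top_inf_eq, hker, LinearMap.range_eq_map]
      exact this.fg_top.map i

theorem extension {X : ModuleCat.{v} Λ} (hX : FiltBy V X) :
    ∀ {Y Z : ModuleCat.{v} Λ} (f : X →ₗ[Λ] Y) (g : Y →ₗ[Λ] Z), Injective f → Surjective g →
      Exact f g → FiltBy V Z → FiltBy V Y := by
  induction hX with
  | zero X h =>
    intro Y Z f g _ hg hfg hZ
    refine hZ.of_linearEquiv (LinearEquiv.ofBijective g ⟨?_, hg⟩).symm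
    rw [injective_iff_map_eq_zero]
    intro y hy
    obtain ⟨x, rfl⟩ := (hfg y).1 hy
    rw [h x, map_zero]
  | ext S X X' i q hi hq hiq hS hX' ih =>
    intro Y Z f g hf hg hfg hZ
    let N := LinearMap.range (f ∘ₗ i)
    have hN : ∀ x, N.mkQ (f x) = 0 ↔ q x = 0 := by
      intro x
      rw [Submodule.mkQ_apply, Submodule.Quotient.mk_eq_zero, hiq x]
      exact exists_congr fun s => hf.eq_iff
    obtain ⟨f', hf'⟩ := LinearMap.exists_comp_eq_of_surjective q hq (N.mkQ ∘ₗ f)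
      fun x hx => (hN x).2 hx
    obtain ⟨g', hg'⟩ := LinearMap.exists_comp_eq_of_surjective N.mkQ N.mkQ_surjective g (by
      intro y hy
      obtain ⟨s, rfl⟩ := (Submodule.Quotient.mk_eq_zero N).1 hy
      exact hfg.apply_apply_eq_zero (i s))
    refine .ext S Y (.of Λ (Y ⧸ N)) (f ∘ₗ i) N.mkQ (hf.comp hi) N.mkQ_surjective
      (LinearMap.exact_iff.2 N.ker_mkQ) hS (ih (Y := .of Λ (Y ⧸ N)) f' g' ?_ ?_ ?_ hZ)
    · rw [injective_iff_map_eq_zero]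
      intro x' hx'
      obtain ⟨x, rfl⟩ := hq x'
      exact (hN x).1 ((hf' x).symm.trans hx')
    · intro z
      obtain ⟨y, rfl⟩ := hg z
      exact ⟨N.mkQ y, hg' y⟩
    · intro y'
      obtain ⟨y, rfl⟩ := N.mkQ_surjective y'
      rw [hg' y]
      constructor
      · intro hy
        obtain ⟨x, rfl⟩ := (hfg y).1 hy
        exact ⟨q x, hf' x⟩
      · rintro ⟨x', hx'⟩
        obtain ⟨x, rfl⟩ := hq x'
        rw [← hg', ← hx', hf', LinearMap.comp_apply, hg']
        exact hfg.apply_apply_eq_zero x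

section Closed

variable (hequiv : ∀ M N : ModuleCat.{v} Λ, M ∈ V → Nonempty (M ≃ₗ[Λ] N) → N ∈ V)
  (hker : ∀ M N : ModuleCat.{v} Λ, M ∈ V → N ∈ V → ∀ f : M →ₗ[Λ] N,
    ModuleCat.of Λ (LinearMap.ker f) ∈ V)
  (hcoker : ∀ M N : ModuleCat.{v} Λ, M ∈ V → N ∈ V → ∀ f : M →ₗ[Λ] N,
    ModuleCat.of Λ (N ⧸ LinearMap.range f) ∈ V)

include hequiv hker hcoker

theorem ker_mem_and_coker {S X : ModuleCat.{v} Λ} (hX : FiltBy V X) (hS : S ∈ V) :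
    ∀ f : S →ₗ[Λ] X, ModuleCat.of Λ (LinearMap.ker f) ∈ V ∧
      FiltBy V (.of Λ (X ⧸ LinearMap.range f)) := by
  induction hX with
  | zero X h =>
    intro f
    constructor
    · refine hequiv S _ hS ⟨(LinearEquiv.ofTop _ ?_).symm⟩
      exact eq_top_iff.2 fun x _ => h (f x)
    · refine .zero _ fun y => ?_
      obtain ⟨x, rfl⟩ := Submodule.mkQ_surjective _ y
      rw [h x, map_zero]
  | ext T X X' i q hi hq hiq hT hX' ih =>
    intro f
    obtain ⟨hK, hC⟩ := ih (q ∘ₗ f)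
    obtain ⟨h, hh⟩ := LinearMap.exists_comp_eq_of_injective i hi
      (f ∘ₗ (LinearMap.ker (q ∘ₗ f)).subtype) fun z => (hiq _).1 z.2
    have hzero : ∀ z, h z = 0 ↔ f z = 0 := fun z => by
      rw [← map_eq_zero_iff i hi, hh]
      rfl
    constructor
    · refine hequiv _ _ (hker _ _ hK hT h) ⟨LinearEquiv.ofBijective
        (((LinearMap.ker (q ∘ₗ f)).subtype ∘ₗ (LinearMap.ker h).subtype).codRestrict
          (LinearMap.ker f) fun z => (hzero _).1 z.2) ⟨?_, ?_⟩⟩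
      · intro a b hab
        exact (LinearMap.ker h).subtype_injective ((LinearMap.ker (q ∘ₗ f)).subtype_injective
          (congrArg (LinearMap.ker f).subtype hab))
      · rintro ⟨s, hs⟩
        have hs' : s ∈ LinearMap.ker (q ∘ₗ f) := by
          rw [LinearMap.mem_ker] at hs ⊢
          simp [hs]
        exact ⟨⟨⟨s, hs'⟩, (hzero ⟨s, hs'⟩).2 hs⟩, rfl⟩
    · have hle : LinearMap.range h ≤ (LinearMap.range f).comap i := by
        rintro _ ⟨z, rfl⟩
        exact ⟨z, (hh z).symm⟩
      have hle' : LinearMap.range f ≤ (LinearMap.range (q ∘ₗ f)).comap q := by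
        rintro _ ⟨s, rfl⟩
        exact ⟨s, rfl⟩
      refine .ext (.of Λ (T ⧸ LinearMap.range h)) _ _ (Submodule.mapQ _ _ i hle)
        (Submodule.mapQ _ _ q hle') ?_ ?_ ?_ (hcoker _ _ hK hT h) hC
      · rw [injective_iff_map_eq_zero]
        intro t' ht'
        obtain ⟨t, rfl⟩ := Submodule.mkQ_surjective _ t'
        obtain ⟨s, hs⟩ := (Submodule.Quotient.mk_eq_zero _).1 ht'
        have hs' : s ∈ LinearMap.ker (q ∘ₗ f) := by
          rw [LinearMap.mem_ker, LinearMap.comp_apply, hs]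
          exact hiq.apply_apply_eq_zero t
        exact (Submodule.Quotient.mk_eq_zero _).2 ⟨⟨s, hs'⟩, hi ((hh _).trans hs)⟩
      · intro y
        obtain ⟨x', rfl⟩ := Submodule.mkQ_surjective _ y
        obtain ⟨x, rfl⟩ := hq x'
        exact ⟨Submodule.Quotient.mk x, rfl⟩
      · intro y
        obtain ⟨x, rfl⟩ := Submodule.mkQ_surjective _ y
        constructor
        · intro hx
          obtain ⟨s, hs⟩ := (Submodule.Quotient.mk_eq_zero _).1 hx
          obtain ⟨t, ht⟩ := (hiq (x - f s)).1 (by rw [map_sub, sub_eq_zero]; exact hs.symm)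
          refine ⟨Submodule.Quotient.mk t, (Submodule.Quotient.eq _).2 ⟨-s, ?_⟩⟩
          rw [ht, map_neg]
          abel
        · rintro ⟨t', ht'⟩
          obtain ⟨t, rfl⟩ := Submodule.mkQ_surjective _ t'
          rw [← ht']
          change Submodule.Quotient.mk (q (i t)) = 0
          rw [hiq.apply_apply_eq_zero t, Submodule.Quotient.mk_zero]

theorem ker_and_coker {X : ModuleCat.{v} Λ} (hX : FiltBy V X) :
    ∀ {Y : ModuleCat.{v} Λ} (f : X →ₗ[Λ] Y), FiltBy V Y →
      FiltBy V (.of Λ (LinearMap.ker f)) ∧ FiltBy V (.of Λ (Y ⧸ LinearMap.range f)) := by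
  induction hX with
  | zero X h =>
    intro Y f hY
    refine ⟨.zero _ fun x => Subtype.ext (h x), hY.of_linearEquiv
      (Submodule.quotEquivOfEqBot _ ?_).symm⟩
    rw [LinearMap.range_eq_bot]
    ext x
    rw [h x, map_zero, map_zero]
  | ext S X X' i q hi hq hiq hS hX' ih =>
    intro Y f hY
    obtain ⟨hK, hC⟩ := ker_mem_and_coker hequiv hker hcoker hY hS (f ∘ₗ i)
    obtain ⟨f', hf'⟩ := LinearMap.exists_comp_eq_of_surjective q hq
      ((LinearMap.range (f ∘ₗ i)).mkQ ∘ₗ f) (by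
        intro x hx
        obtain ⟨s, rfl⟩ := (hiq x).1 hx
        exact (Submodule.Quotient.mk_eq_zero _).2 ⟨s, rfl⟩)
    have hf'0 : ∀ x, f' (q x) = 0 ↔ ∃ s, f (i s) = f x := fun x => by
      rw [hf']
      exact Submodule.Quotient.mk_eq_zero _
    obtain ⟨hK', hC'⟩ := ih (Y := .of Λ (Y ⧸ LinearMap.range (f ∘ₗ i))) f' hC
    constructor
    · refine .ext _ _ _ (i.restrict (p := LinearMap.ker (f ∘ₗ i)) (q := LinearMap.ker f)
        fun s hs => hs) (q.restrict (p := LinearMap.ker f) (q := LinearMap.ker f') fun x hx => ?_)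
        ?_ ?_ ?_ hK hK'
      · exact (hf'0 x).2 ⟨0, by rw [map_zero, map_zero]; exact hx.symm⟩
      · intro a b hab
        exact Subtype.ext (hi (congrArg Subtype.val hab))
      · rintro ⟨x', hx'⟩
        obtain ⟨x, rfl⟩ := hq x'
        obtain ⟨s, hs⟩ := (hf'0 x).1 hx'
        refine ⟨⟨x - i s, ?_⟩, Subtype.ext ?_⟩
        · rw [LinearMap.mem_ker, map_sub, hs, sub_self]
        · change q (x - i s) = q x
          rw [map_sub, hiq.apply_apply_eq_zero, sub_zero]
      · rintro ⟨x, hx⟩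
        constructor
        · intro h
          obtain ⟨s, rfl⟩ := (hiq x).1 (congrArg Subtype.val h)
          exact ⟨⟨s, hx⟩, rfl⟩
        · rintro ⟨s, hs⟩
          refine Subtype.ext ?_
          change q x = 0
          rw [← show i s = x from congrArg Subtype.val hs]
          exact hiq.apply_apply_eq_zero _
    · have hmem : ∀ y, (LinearMap.range (f ∘ₗ i)).mkQ y ∈ LinearMap.range f' ↔
          y ∈ LinearMap.range f := by
        intro y
        constructor
        · rintro ⟨x', hx'⟩
          obtain ⟨x, rfl⟩ := hq x'
          rw [hf'] at hx'
          obtain ⟨s, hs⟩ := (Submodule.Quotient.eq _).1 hx'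
          refine ⟨x - i s, ?_⟩
          rw [map_sub, ← LinearMap.comp_apply f i, hs]
          abel
        · rintro ⟨x, rfl⟩
          exact ⟨q x, hf' x⟩
      refine hC'.of_linearEquiv (LinearEquiv.ofBijective ((LinearMap.range f).liftQ
        ((LinearMap.range f').mkQ ∘ₗ (LinearMap.range (f ∘ₗ i)).mkQ) ?_) ⟨?_, ?_⟩).symm
      · intro y hy
        exact (Submodule.Quotient.mk_eq_zero _).2 ((hmem y).2 hy)
      · rw [injective_iff_map_eq_zero]
        intro y' hy'
        obtain ⟨y, rfl⟩ := Submodule.mkQ_surjective _ y'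
        exact (Submodule.Quotient.mk_eq_zero _).2
          ((hmem y).1 ((Submodule.Quotient.mk_eq_zero _).1 hy'))
      · intro z
        obtain ⟨y', rfl⟩ := Submodule.mkQ_surjective _ z
        obtain ⟨y, rfl⟩ := Submodule.mkQ_surjective _ y'
        exact ⟨Submodule.Quotient.mk y, rfl⟩

theorem isWideCat (hV : V ⊆ fgMods Λ) : IsWideCat Λ {M | FiltBy V M} := by
  refine ⟨fun M hM => hM.finite hV, fun M N hM _ ⟨e⟩ => hM.of_linearEquiv e,
    fun M _ h => .zero M h, ?_, ?_, ?_, ?_⟩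
  · rintro M N P hM hN - ⟨i, j, hij⟩
    let e := LinearEquiv.ofBijective (i.coprod j) hij
    have hinl : ∀ m, e (m, 0) = i m := fun m => by
      change i m + j 0 = i m
      rw [map_zero, add_zero]
    refine FiltBy.extension hM i (LinearMap.snd Λ M N ∘ₗ e.symm.toLinearMap) ?_ ?_ ?_ hN
    · intro a b hab
      rw [← hinl, ← hinl] at hab
      exact congrArg Prod.fst (e.injective hab)
    · exact (LinearMap.snd_surjective (R := Λ) (M := M) (M₂ := N)).comp e.symm.surjective
    · intro p
      obtain ⟨⟨m, n⟩, rfl⟩ := e.surjective p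
      rw [LinearMap.comp_apply, LinearEquiv.coe_coe, e.symm_apply_apply, LinearMap.snd_apply]
      constructor
      · rintro rfl
        exact ⟨m, (hinl m).symm⟩
      · rintro ⟨m', hm'⟩
        rw [← hinl] at hm'
        exact (congrArg Prod.snd (e.injective hm')).symm
  · rintro M N hM hN f K - ⟨e⟩
    exact (ker_and_coker hequiv hker hcoker hM f hN).1.of_linearEquiv e.symm
  · rintro M N hM hN f C - ⟨e⟩
    exact (ker_and_coker hequiv hker hcoker hM f hN).2.of_linearEquiv e.symm
  · intro X Z hX hZ Y _ f g hf hg hfg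
    exact FiltBy.extension hX f g hf hg hfg hZ

end Closed

end FiltBy

theorem mem_modOver_of_surjective {Λ' : Type} [Ring Λ'] {φ : Λ →+* Λ'} {M N : ModuleCat.{v} Λ}
    (hM : M ∈ modOver Λ φ) (f : M →ₗ[Λ] N) (hf : Surjective f) : N ∈ modOver Λ φ := by
  have : Module.Finite Λ M := hM.1
  refine ⟨Module.Finite.of_surjective f hf, fun x hx n => ?_⟩
  obtain ⟨m, rfl⟩ := hf n
  rw [← map_smul, hM.2 x hx, map_zero]

theorem mem_modOver_of_submodule [IsNoetherianRing Λ] {Λ' : Type} [Ring Λ'] {φ : Λ →+* Λ'}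
    {M : ModuleCat.{v} Λ} (hM : M ∈ modOver Λ φ) (N : Submodule Λ M) :
    ModuleCat.of Λ N ∈ modOver Λ φ := by
  have : Module.Finite Λ M := hM.1
  exact ⟨inferInstanceAs (Module.Finite Λ N), fun x hx n => Subtype.ext (hM.2 x hx n)⟩

/-- Filtrations in `mod Λ` extend a wide subcategory of `mod Λ'` to one of `mod Λ`. -/
theorem exists_isWideCat_inter_modOver_eq [IsNoetherianRing Λ] {Λ' : Type} [Ring Λ']
    (φ : Λ →+* Λ') {V : Set (ModuleCat.{v} Λ)} (hV : IsWideIn Λ (modOver Λ φ) V) :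
    ∃ W, IsWideCat Λ W ∧ W ∩ modOver Λ φ = V := by
  obtain ⟨hsub, hequiv, hzero, -, hker, hcoker, hext⟩ := hV
  refine ⟨{M | FiltBy V M}, FiltBy.isWideCat ?_ ?_ ?_ (hsub.trans (modOver_subset_fgMods φ)), ?_⟩
  · rintro M N hM ⟨e⟩
    exact hequiv M N hM (mem_modOver_of_surjective (hsub hM) e.toLinearMap e.surjective) ⟨e⟩
  · intro M N hM hN f
    exact hker M N hM hN f _ (mem_modOver_of_submodule (hsub hM) _) ⟨LinearEquiv.refl _ _⟩
  · intro M N hM hN f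
    exact hcoker M N hM hN f _ (mem_modOver_of_surjective (N := .of Λ (N ⧸ LinearMap.range f))
      (hsub hN) (Submodule.mkQ _) (Submodule.mkQ_surjective _)) ⟨LinearEquiv.refl _ _⟩
  · refine Set.Subset.antisymm ?_ fun M hM => ⟨FiltBy.of_mem hM, hsub hM⟩
    rintro M ⟨hM, hMA⟩
    induction hM with
    | zero M h => exact hzero M hMA h
    | ext X Y Z i q hi hq hiq hX hZ ih =>
      exact hext X Z hX (ih (mem_modOver_of_surjective hMA q hq)) Y hMA i q hi hq hiq

end Filtrations

/-- **Statement 18.** Let `φ : B ↠ A` be an epimorphism of finite-dimensional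
`k`-algebras and `ℳ` a full subcategory of `mod B` containing `mod A`. Then
(1) the poset `widshad_ℳ(B)` of `ℳ`-wide shadows is a complete lattice, and
(2) the maps `(−) ∩ ℳ : wide(B) → widshad_ℳ(B)` and
`(−) ∩ mod(A) : widshad_ℳ(B) → wide(A)` are surjective meet-semilattice
homomorphisms. -/
theorem statement18 (k : Type) [Field k] (B A : Type) [Ring B] [Ring A]
    [Algebra k B] [FiniteDimensional k B] [Algebra k A] [FiniteDimensional k A]
    (φ : B →+* A) (hφ : Function.Surjective φ)
    (Mcal : Set (ModuleCat B)) (hMcal : Mcal ⊆ fgMods B) (hM2 : modOver B φ ⊆ Mcal) :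
    -- (1) `widshad_ℳ(B)` is a complete lattice (ordered by inclusion):
    (∀ s : Set (Set (ModuleCat B)), (∀ S ∈ s, IsWideShadow B Mcal S) →
      (∃ j, IsLubIn {S | IsWideShadow B Mcal S} s j) ∧
      (∃ m, IsGlbIn {S | IsWideShadow B Mcal S} s m)) ∧
    -- (2a) `(−) ∩ ℳ : wide(B) → widshad_ℳ(B)` is a surjective
    -- meet-semilattice homomorphism:
    (∀ W, IsWideCat B W → IsWideShadow B Mcal (W ∩ Mcal)) ∧
    (∀ S, IsWideShadow B Mcal S → ∃ W, IsWideCat B W ∧ W ∩ Mcal = S) ∧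
    (∀ W W' m, IsWideCat B W → IsWideCat B W' →
      IsGlbIn {U | IsWideCat B U} {W, W'} m →
      IsGlbIn {S | IsWideShadow B Mcal S} {W ∩ Mcal, W' ∩ Mcal} (m ∩ Mcal)) ∧
    -- (2b) `(−) ∩ mod(A) : widshad_ℳ(B) → wide(A)` is a surjective
    -- meet-semilattice homomorphism:
    (∀ S, IsWideShadow B Mcal S → IsWideIn B (modOver B φ) (S ∩ modOver B φ)) ∧
    (∀ V, IsWideIn B (modOver B φ) V →
      ∃ S, IsWideShadow B Mcal S ∧ S ∩ modOver B φ = V) ∧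
    (∀ S S' m, IsWideShadow B Mcal S → IsWideShadow B Mcal S' →
      IsGlbIn {U | IsWideShadow B Mcal U} {S, S'} m →
      IsGlbIn {V | IsWideIn B (modOver B φ) V}
        {S ∩ modOver B φ, S' ∩ modOver B φ} (m ∩ modOver B φ)) := by
  have : IsNoetherianRing B := IsNoetherianRing.of_finite k B
  have hshadow : ∀ S, IsWideShadow B Mcal S → IsWideIn B (modOver B φ) (S ∩ modOver B φ) := by
    rintro _ ⟨W, hW, rfl⟩
    rw [Set.inter_assoc, Set.inter_eq_right.2 hM2]
    exact hW.inter_of_subset (modOver_subset_fgMods φ)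
  refine ⟨fun s hs => ⟨IsWideShadow.exists_isLubIn hMcal hs, IsWideShadow.exists_isGlbIn hMcal hs⟩,
    fun W hW => ⟨W, hW, rfl⟩, ?_, ?_, hshadow, ?_, ?_⟩
  · rintro _ ⟨W, hW, rfl⟩
    exact ⟨W, hW, rfl⟩
  · intro W W' m hW hW' hm
    exact isGlbIn_pair_inter_right (hW.inter hW')
      (IsWideShadow.inter ⟨W, hW, rfl⟩ ⟨W', hW', rfl⟩) hm
  · intro V hV
    obtain ⟨W, hW, hWV⟩ := exists_isWideCat_inter_modOver_eq φ hV
    exact ⟨W ∩ Mcal, ⟨W, hW, rfl⟩, by rw [Set.inter_assoc, Set.inter_eq_right.2 hM2, hWV]⟩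
  · intro S S' m hS hS' hm
    exact isGlbIn_pair_inter_right (hS.inter hS') ((hshadow S hS).inter (hshadow S' hS')) hm
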